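/- arXiv:2203.13045 — 2 statements merged into one kernel-verified Lean document; each statement's English description precedes it below -/
import Mathlib

section
/- Let (u,v) be a smooth solution of the Pavlov–Mikhalev system on ℝ³ and let ϑ : ℝ → ℝ be an arbitrary smooth function of t, with ϑ_t its derivative. Then the pair (φ^u, φ^v) with φ^u = u_x·ϑ(t) − y·ϑ_t(t) and φ^v = v_x·ϑ(t) satisfies the linearized system, i.e., it is a symmetry generating function (the symmetry φ₄[ϑ]). -/
noncomputable section

/-- Partial derivative with respect to the first coordinate `t`. -/
def Dt (f : ℝ → ℝ → ℝ → ℝ) : ℝ → ℝ → ℝ → ℝ := fun t x y => deriv (fun s => f s x y) t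

/-- Partial derivative with respect to the second coordinate `x`. -/
def Dx (f : ℝ → ℝ → ℝ → ℝ) : ℝ → ℝ → ℝ → ℝ := fun t x y => deriv (fun s => f t s y) x

/-- Partial derivative with respect to the third coordinate `y`. -/
def Dy (f : ℝ → ℝ → ℝ → ℝ) : ℝ → ℝ → ℝ → ℝ := fun t x y => deriv (fun s => f t x s) y

/-- `f` is a smooth function on `ℝ³` (given in curried form, coordinates `(t, x, y)`). -/
def Smooth3 (f : ℝ → ℝ → ℝ → ℝ) : Prop :=
  ContDiff ℝ (⊤ : ℕ∞) (fun p : ℝ × ℝ × ℝ => f p.1 p.2.1 p.2.2)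

/-- The Pavlov–Mikhalev equation `u_yy = u_xt − u_x·u_xy + u_y·u_xx`. -/
def PMu (u : ℝ → ℝ → ℝ → ℝ) : Prop :=
  ∀ t x y : ℝ, Dy (Dy u) t x y =
    Dt (Dx u) t x y - Dx u t x y * Dy (Dx u) t x y + Dy u t x y * Dx (Dx u) t x y

/-- The second equation of the two-component Pavlov–Mikhalev system:
`v_yy = v_xt − u_x·v_xy − 2·v_y·u_xx + 2·v_x·u_xy + u_y·v_xx`. -/
def PMv (u v : ℝ → ℝ → ℝ → ℝ) : Prop :=
  ∀ t x y : ℝ, Dy (Dy v) t x y =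
    Dt (Dx v) t x y - Dx u t x y * Dy (Dx v) t x y
      - 2 * Dy v t x y * Dx (Dx u) t x y + 2 * Dx v t x y * Dy (Dx u) t x y
      + Dy u t x y * Dx (Dx v) t x y

/-- First equation of the linearized system applied to `A = φ^u`:
`φ^u_yy = φ^u_xt + u_xx·φ^u_y + u_y·φ^u_xx − u_x·φ^u_xy − u_xy·φ^u_x`. -/
def LinU (u A : ℝ → ℝ → ℝ → ℝ) : Prop :=
  ∀ t x y : ℝ, Dy (Dy A) t x y =
    Dt (Dx A) t x y + Dx (Dx u) t x y * Dy A t x y + Dy u t x y * Dx (Dx A) t x y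
      - Dx u t x y * Dy (Dx A) t x y - Dy (Dx u) t x y * Dx A t x y

/-- Second equation of the linearized system applied to `(A, B) = (φ^u, φ^v)`. -/
def LinV (u v A B : ℝ → ℝ → ℝ → ℝ) : Prop :=
  ∀ t x y : ℝ, Dy (Dy B) t x y =
    2 * Dx v t x y * Dy (Dx A) t x y - Dy (Dx v) t x y * Dx A t x y
      + Dx (Dx v) t x y * Dy A t x y - 2 * Dy v t x y * Dx (Dx A) t x y
      + Dt (Dx B) t x y + 2 * Dy (Dx u) t x y * Dx B t x y
      - 2 * Dx (Dx u) t x y * Dy B t x y + Dy u t x y * Dx (Dx B) t x y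
      - Dx u t x y * Dy (Dx B) t x y

/-- `(A,B)` is a symmetry generating function of the Pavlov–Mikhalev system over `(u,v)`. -/
def IsSymmetry (u v A B : ℝ → ℝ → ℝ → ℝ) : Prop := LinU u A ∧ LinV u v A B

/-- First equation of the tangent system over a solution `(u,v)`:
`p_yy = u_y·p_xx − u_xy·p_x − u_x·p_xy + u_xx·p_y + p_xt`. -/
def TanP (u p : ℝ → ℝ → ℝ → ℝ) : Prop :=
  ∀ t x y : ℝ, Dy (Dy p) t x y =
    Dy u t x y * Dx (Dx p) t x y - Dy (Dx u) t x y * Dx p t x y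
      - Dx u t x y * Dy (Dx p) t x y + Dx (Dx u) t x y * Dy p t x y + Dt (Dx p) t x y

/-- Second equation of the tangent system over a solution `(u,v)`:
`q_yy = 2·v_x·p_xy + v_xx·p_y − v_xy·p_x − 2·v_y·p_xx + 2·u_xy·q_x + u_y·q_xx
  − u_x·q_xy − 2·u_xx·q_y + q_xt`. -/
def TanQ (u v p q : ℝ → ℝ → ℝ → ℝ) : Prop :=
  ∀ t x y : ℝ, Dy (Dy q) t x y =
    2 * Dx v t x y * Dy (Dx p) t x y + Dx (Dx v) t x y * Dy p t x y
      - Dy (Dx v) t x y * Dx p t x y - 2 * Dy v t x y * Dx (Dx p) t x y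
      + 2 * Dy (Dx u) t x y * Dx q t x y + Dy u t x y * Dx (Dx q) t x y
      - Dx u t x y * Dy (Dx q) t x y - 2 * Dx (Dx u) t x y * Dy q t x y
      + Dt (Dx q) t x y

theorem hasDerivAt_fst (t x y : ℝ) :
    HasDerivAt (fun s : ℝ => ((s, x, y) : ℝ × ℝ × ℝ)) (1, 0, 0) t :=
  (hasDerivAt_id t).prodMk ((hasDerivAt_const t x).prodMk (hasDerivAt_const t y))

theorem hasDerivAt_snd_fst (t x y : ℝ) :
    HasDerivAt (fun s : ℝ => ((t, s, y) : ℝ × ℝ × ℝ)) (0, 1, 0) x :=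
  (hasDerivAt_const x t).prodMk ((hasDerivAt_id x).prodMk (hasDerivAt_const x y))

theorem hasDerivAt_snd_snd (t x y : ℝ) :
    HasDerivAt (fun s : ℝ => ((t, x, s) : ℝ × ℝ × ℝ)) (0, 0, 1) y :=
  (hasDerivAt_const y t).prodMk ((hasDerivAt_const y x).prodMk (hasDerivAt_id y))

namespace Smooth3

variable {f : ℝ → ℝ → ℝ → ℝ}

theorem hasFDerivAt (hf : Smooth3 f) (p : ℝ × ℝ × ℝ) :
    HasFDerivAt (fun p : ℝ × ℝ × ℝ => f p.1 p.2.1 p.2.2)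
      (fderiv ℝ (fun p : ℝ × ℝ × ℝ => f p.1 p.2.1 p.2.2) p) p :=
  (ContDiff.differentiable hf (by simp) p).hasFDerivAt

theorem hasDerivAt_comp (hf : Smooth3 f) {c : ℝ → ℝ × ℝ × ℝ} {c' : ℝ × ℝ × ℝ} {s : ℝ}
    (hc : HasDerivAt c c' s) :
    HasDerivAt (fun r => f (c r).1 (c r).2.1 (c r).2.2)
      (fderiv ℝ (fun p : ℝ × ℝ × ℝ => f p.1 p.2.1 p.2.2) (c s) c') s :=
  (hf.hasFDerivAt (c s)).comp_hasDerivAt s hc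

theorem dt_eq (hf : Smooth3 f) (t x y : ℝ) :
    Dt f t x y = fderiv ℝ (fun p : ℝ × ℝ × ℝ => f p.1 p.2.1 p.2.2) (t, x, y) (1, 0, 0) :=
  (hf.hasDerivAt_comp (hasDerivAt_fst t x y)).deriv

theorem dx_eq (hf : Smooth3 f) (t x y : ℝ) :
    Dx f t x y = fderiv ℝ (fun p : ℝ × ℝ × ℝ => f p.1 p.2.1 p.2.2) (t, x, y) (0, 1, 0) :=
  (hf.hasDerivAt_comp (hasDerivAt_snd_fst t x y)).deriv

theorem dy_eq (hf : Smooth3 f) (t x y : ℝ) :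
    Dy f t x y = fderiv ℝ (fun p : ℝ × ℝ × ℝ => f p.1 p.2.1 p.2.2) (t, x, y) (0, 0, 1) :=
  (hf.hasDerivAt_comp (hasDerivAt_snd_snd t x y)).deriv

theorem hasDerivAt_t (hf : Smooth3 f) (t x y : ℝ) :
    HasDerivAt (fun s => f s x y) (Dt f t x y) t :=
  (hf.hasDerivAt_comp (hasDerivAt_fst t x y)).differentiableAt.hasDerivAt

theorem hasDerivAt_x (hf : Smooth3 f) (t x y : ℝ) :
    HasDerivAt (fun s => f t s y) (Dx f t x y) x :=
  (hf.hasDerivAt_comp (hasDerivAt_snd_fst t x y)).differentiableAt.hasDerivAt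

theorem hasDerivAt_y (hf : Smooth3 f) (t x y : ℝ) :
    HasDerivAt (fun s => f t x s) (Dy f t x y) y :=
  (hf.hasDerivAt_comp (hasDerivAt_snd_snd t x y)).differentiableAt.hasDerivAt

theorem contDiff_fderiv (hf : Smooth3 f) :
    ContDiff ℝ (⊤ : ℕ∞) (fderiv ℝ fun p : ℝ × ℝ × ℝ => f p.1 p.2.1 p.2.2) :=
  ContDiff.fderiv_right hf (by simp)

theorem dt (hf : Smooth3 f) : Smooth3 (Dt f) := by
  simp only [Smooth3, hf.dt_eq]
  exact hf.contDiff_fderiv.clm_apply contDiff_const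

theorem dx (hf : Smooth3 f) : Smooth3 (Dx f) := by
  simp only [Smooth3, hf.dx_eq]
  exact hf.contDiff_fderiv.clm_apply contDiff_const

theorem dy (hf : Smooth3 f) : Smooth3 (Dy f) := by
  simp only [Smooth3, hf.dy_eq]
  exact hf.contDiff_fderiv.clm_apply contDiff_const

theorem fderiv_fderiv_apply (hf : Smooth3 f) (p v w : ℝ × ℝ × ℝ) :
    fderiv ℝ (fun q => fderiv ℝ (fun p : ℝ × ℝ × ℝ => f p.1 p.2.1 p.2.2) q v) p w =
      fderiv ℝ (fun q => fderiv ℝ (fun p : ℝ × ℝ × ℝ => f p.1 p.2.1 p.2.2) q w) p v := by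
  have hd := hf.contDiff_fderiv.differentiable (by simp) p
  have hs : IsSymmSndFDerivAt ℝ (fun p : ℝ × ℝ × ℝ => f p.1 p.2.1 p.2.2) p :=
    (ContDiff.contDiffAt hf).isSymmSndFDerivAt
      (by simpa using WithTop.coe_le_coe.2 (le_top : (2 : ℕ∞) ≤ ⊤))
  rw [fderiv_clm_apply hd (by fun_prop), fderiv_clm_apply hd (by fun_prop)]
  simpa using hs w v

theorem dx_dt (hf : Smooth3 f) : Dx (Dt f) = Dt (Dx f) := by
  funext t x y
  rw [hf.dt.dx_eq, hf.dx.dt_eq]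
  simp only [hf.dt_eq, hf.dx_eq]
  exact hf.fderiv_fderiv_apply _ _ _

theorem dx_dy (hf : Smooth3 f) : Dx (Dy f) = Dy (Dx f) := by
  funext t x y
  rw [hf.dy.dx_eq, hf.dx.dy_eq]
  simp only [hf.dy_eq, hf.dx_eq]
  exact hf.fderiv_fderiv_apply _ _ _

end Smooth3

theorem PMu.dx {u : ℝ → ℝ → ℝ → ℝ} (h : PMu u) (hu : Smooth3 u) (t x y : ℝ) :
    Dy (Dy (Dx u)) t x y =
      Dt (Dx (Dx u)) t x y - Dx u t x y * Dy (Dx (Dx u)) t x y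
        + Dy u t x y * Dx (Dx (Dx u)) t x y := by
  have hl := hu.dy.dy.hasDerivAt_x t x y
  have hr := ((hu.dx.dt.hasDerivAt_x t x y).sub
    ((hu.dx.hasDerivAt_x t x y).mul (hu.dx.dy.hasDerivAt_x t x y))).add
    ((hu.dy.hasDerivAt_x t x y).mul (hu.dx.dx.hasDerivAt_x t x y))
  have he := hl.unique (hr.congr_of_eventuallyEq (.of_forall fun s => h t s y))
  rw [hu.dy.dx_dy, hu.dx_dy, hu.dx.dx_dt, hu.dx.dx_dy] at he
  linear_combination he

theorem PMv.dx {u v : ℝ → ℝ → ℝ → ℝ} (h : PMv u v) (hu : Smooth3 u) (hv : Smooth3 v)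
    (t x y : ℝ) :
    Dy (Dy (Dx v)) t x y =
      Dt (Dx (Dx v)) t x y - 3 * Dx (Dx u) t x y * Dy (Dx v) t x y
        - Dx u t x y * Dy (Dx (Dx v)) t x y - 2 * Dy v t x y * Dx (Dx (Dx u)) t x y
        + 3 * Dx (Dx v) t x y * Dy (Dx u) t x y + 2 * Dx v t x y * Dy (Dx (Dx u)) t x y
        + Dy u t x y * Dx (Dx (Dx v)) t x y := by
  have hl := hv.dy.dy.hasDerivAt_x t x y
  have hr := ((((hv.dx.dt.hasDerivAt_x t x y).sub
    ((hu.dx.hasDerivAt_x t x y).mul (hv.dx.dy.hasDerivAt_x t x y))).sub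
    (((hv.dy.hasDerivAt_x t x y).const_mul 2).mul (hu.dx.dx.hasDerivAt_x t x y))).add
    (((hv.dx.hasDerivAt_x t x y).const_mul 2).mul (hu.dx.dy.hasDerivAt_x t x y))).add
    ((hu.dy.hasDerivAt_x t x y).mul (hv.dx.dx.hasDerivAt_x t x y))
  have he := hl.unique (hr.congr_of_eventuallyEq (.of_forall fun s => h t s y))
  rw [hv.dy.dx_dy, hv.dx_dy, hv.dx.dx_dt, hv.dx.dx_dy, hu.dx_dy, hu.dx.dx_dy] at he
  linear_combination he

section SeparatedProduct

variable {f : ℝ → ℝ → ℝ → ℝ} {a b : ℝ → ℝ}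

theorem Dt_mul_fst (hf : Smooth3 f) (ha : Differentiable ℝ a) :
    Dt (fun t x y => f t x y * a t) =
      fun t x y => Dt f t x y * a t + f t x y * deriv a t := by
  funext t x y
  exact ((hf.hasDerivAt_t t x y).mul (ha t).hasDerivAt).deriv

theorem Dx_mul_fst (hf : Smooth3 f) :
    Dx (fun t x y => f t x y * a t) = fun t x y => Dx f t x y * a t := by
  funext t x y
  exact ((hf.hasDerivAt_x t x y).mul_const (a t)).deriv

theorem Dy_mul_fst (hf : Smooth3 f) :
    Dy (fun t x y => f t x y * a t) = fun t x y => Dy f t x y * a t := by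
  funext t x y
  exact ((hf.hasDerivAt_y t x y).mul_const (a t)).deriv

theorem Dx_mul_fst_sub (hf : Smooth3 f) :
    Dx (fun t x y => f t x y * a t - y * b t) = fun t x y => Dx f t x y * a t := by
  funext t x y
  exact (((hf.hasDerivAt_x t x y).mul_const (a t)).sub_const (y * b t)).deriv

theorem Dy_mul_fst_sub (hf : Smooth3 f) :
    Dy (fun t x y => f t x y * a t - y * b t) = fun t x y => Dy f t x y * a t - b t := by
  funext t x y
  refine (((hf.hasDerivAt_y t x y).mul_const (a t)).sub
    ((hasDerivAt_id y).mul_const (b t))).deriv.trans ?_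
  rw [one_mul]

theorem Dy_mul_fst_sub_fst (hf : Smooth3 f) :
    Dy (fun t x y => f t x y * a t - b t) = fun t x y => Dy f t x y * a t := by
  funext t x y
  exact (((hf.hasDerivAt_y t x y).mul_const (a t)).sub_const (b t)).deriv

end SeparatedProduct

theorem phi4_is_symmetry (u v : ℝ → ℝ → ℝ → ℝ) (hu : Smooth3 u) (hv : Smooth3 v)
    (hPMu : PMu u) (hPMv : PMv u v)
    (ϑ : ℝ → ℝ) (hϑ : ContDiff ℝ (⊤ : ℕ∞) ϑ) :
    IsSymmetry u v
      (fun t x y => Dx u t x y * ϑ t - y * deriv ϑ t)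
      (fun t x y => Dx v t x y * ϑ t) := by
  have hd : Differentiable ℝ ϑ := hϑ.differentiable (by simp)
  constructor
  · intro t x y
    simp only [Dx_mul_fst_sub hu.dx, Dy_mul_fst_sub hu.dx, Dy_mul_fst_sub_fst hu.dx.dy,
      Dx_mul_fst hu.dx.dx, Dy_mul_fst hu.dx.dx, Dt_mul_fst hu.dx.dx hd]
    linear_combination ϑ t * hPMu.dx hu t x y
  · intro t x y
    simp only [Dx_mul_fst_sub hu.dx, Dy_mul_fst_sub hu.dx, Dx_mul_fst hu.dx.dx,
      Dy_mul_fst hu.dx.dx, Dx_mul_fst hv.dx, Dy_mul_fst hv.dx, Dy_mul_fst hv.dx.dy,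
      Dx_mul_fst hv.dx.dx, Dy_mul_fst hv.dx.dx, Dt_mul_fst hv.dx.dx hd]
    linear_combination ϑ t * hPMv.dx hu hv t x y
end
end

section
/- (Conservation law ω₁ of the tangent equation.) Let (u,v) be a smooth solution of the Pavlov–Mikhalev system on ℝ³ and let (p,q) be a smooth solution of the tangent system. Set X₁ = 2·u_x·p_x + p_y and Y₁ = u_y·p_x + u_x·p_y + p_t. Then ∂_y(X₁) = ∂_x(Y₁) at every point of ℝ³. -/
noncomputable section

/-- The uncurried form of a function of `(t, x, y)`. -/
def uncurry3 (f : ℝ → ℝ → ℝ → ℝ) : ℝ × ℝ × ℝ → ℝ := fun z => f z.1 z.2.1 z.2.2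

theorem Smooth3.contDiff {f : ℝ → ℝ → ℝ → ℝ} (hf : Smooth3 f) :
    ContDiff ℝ (⊤ : ℕ∞) (uncurry3 f) := hf

theorem Smooth3.differentiable {f : ℝ → ℝ → ℝ → ℝ} (hf : Smooth3 f) :
    Differentiable ℝ (uncurry3 f) := hf.contDiff.differentiable (by simp)

theorem Smooth3.hasDerivAt_t_s12 {f : ℝ → ℝ → ℝ → ℝ} (hf : Smooth3 f) (t x y : ℝ) :
    HasDerivAt (fun s => f s x y) (fderiv ℝ (uncurry3 f) (t, x, y) (1, 0, 0)) t :=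
  (hf.differentiable (t, x, y)).hasFDerivAt.comp_hasDerivAt (f := fun s : ℝ => (s, x, y)) t
    ((hasDerivAt_id t).prodMk ((hasDerivAt_const t x).prodMk (hasDerivAt_const t y)))

theorem Smooth3.hasDerivAt_x_s12 {f : ℝ → ℝ → ℝ → ℝ} (hf : Smooth3 f) (t x y : ℝ) :
    HasDerivAt (fun s => f t s y) (fderiv ℝ (uncurry3 f) (t, x, y) (0, 1, 0)) x :=
  (hf.differentiable (t, x, y)).hasFDerivAt.comp_hasDerivAt (f := fun s : ℝ => (t, s, y)) x
    ((hasDerivAt_const x t).prodMk ((hasDerivAt_id x).prodMk (hasDerivAt_const x y)))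

theorem Smooth3.hasDerivAt_y_s12 {f : ℝ → ℝ → ℝ → ℝ} (hf : Smooth3 f) (t x y : ℝ) :
    HasDerivAt (fun s => f t x s) (fderiv ℝ (uncurry3 f) (t, x, y) (0, 0, 1)) y :=
  (hf.differentiable (t, x, y)).hasFDerivAt.comp_hasDerivAt (f := fun s : ℝ => (t, x, s)) y
    ((hasDerivAt_const y t).prodMk ((hasDerivAt_const y x).prodMk (hasDerivAt_id y)))

theorem Smooth3.hasDerivAt_Dx {f : ℝ → ℝ → ℝ → ℝ} (hf : Smooth3 f) (t x y : ℝ) :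
    HasDerivAt (fun s => f t s y) (Dx f t x y) x :=
  (hf.hasDerivAt_x_s12 t x y).differentiableAt.hasDerivAt

theorem Smooth3.hasDerivAt_Dy {f : ℝ → ℝ → ℝ → ℝ} (hf : Smooth3 f) (t x y : ℝ) :
    HasDerivAt (fun s => f t x s) (Dy f t x y) y :=
  (hf.hasDerivAt_y_s12 t x y).differentiableAt.hasDerivAt

theorem Smooth3.uncurry3_Dt {f : ℝ → ℝ → ℝ → ℝ} (hf : Smooth3 f) :
    uncurry3 (Dt f) = fun z => fderiv ℝ (uncurry3 f) z (1, 0, 0) :=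
  funext fun z => (hf.hasDerivAt_t_s12 z.1 z.2.1 z.2.2).deriv

theorem Smooth3.uncurry3_Dx {f : ℝ → ℝ → ℝ → ℝ} (hf : Smooth3 f) :
    uncurry3 (Dx f) = fun z => fderiv ℝ (uncurry3 f) z (0, 1, 0) :=
  funext fun z => (hf.hasDerivAt_x_s12 z.1 z.2.1 z.2.2).deriv

theorem Smooth3.uncurry3_Dy {f : ℝ → ℝ → ℝ → ℝ} (hf : Smooth3 f) :
    uncurry3 (Dy f) = fun z => fderiv ℝ (uncurry3 f) z (0, 0, 1) :=
  funext fun z => (hf.hasDerivAt_y_s12 z.1 z.2.1 z.2.2).deriv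

theorem contDiff_fderiv_apply_const {E : Type*} [NormedAddCommGroup E] [NormedSpace ℝ E]
    {F : E → ℝ} (hF : ContDiff ℝ (⊤ : ℕ∞) F) (w : E) :
    ContDiff ℝ (⊤ : ℕ∞) (fun z => fderiv ℝ F z w) :=
  (hF.fderiv_right (m := (⊤ : ℕ∞)) (by simp)).clm_apply contDiff_const

theorem Smooth3.smooth3_Dt {f : ℝ → ℝ → ℝ → ℝ} (hf : Smooth3 f) : Smooth3 (Dt f) := by
  change ContDiff ℝ (⊤ : ℕ∞) (uncurry3 (Dt f))
  rw [hf.uncurry3_Dt]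
  exact contDiff_fderiv_apply_const hf.contDiff _

theorem Smooth3.smooth3_Dx {f : ℝ → ℝ → ℝ → ℝ} (hf : Smooth3 f) : Smooth3 (Dx f) := by
  change ContDiff ℝ (⊤ : ℕ∞) (uncurry3 (Dx f))
  rw [hf.uncurry3_Dx]
  exact contDiff_fderiv_apply_const hf.contDiff _

theorem Smooth3.smooth3_Dy {f : ℝ → ℝ → ℝ → ℝ} (hf : Smooth3 f) : Smooth3 (Dy f) := by
  change ContDiff ℝ (⊤ : ℕ∞) (uncurry3 (Dy f))
  rw [hf.uncurry3_Dy]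
  exact contDiff_fderiv_apply_const hf.contDiff _

/-- Directional derivatives of a smooth function commute. -/
theorem fderiv_fderiv_apply_comm {E : Type*} [NormedAddCommGroup E] [NormedSpace ℝ E]
    {F : E → ℝ} (hF : ContDiff ℝ (⊤ : ℕ∞) F) (z a b : E) :
    fderiv ℝ (fun z => fderiv ℝ F z a) z b = fderiv ℝ (fun z => fderiv ℝ F z b) z a := by
  have hd : DifferentiableAt ℝ (fderiv ℝ F) z :=
    (hF.fderiv_right (m := (⊤ : ℕ∞)) (by simp)).differentiable (by simp) z
  have key (c d : E) :
      fderiv ℝ (fun z => fderiv ℝ F z c) z d = fderiv ℝ (fderiv ℝ F) z d c := by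
    rw [fderiv_clm_apply hd (differentiableAt_const c)]
    simp
  rw [key, key]
  exact (hF.contDiffAt.isSymmSndFDerivAt
    (by simpa using WithTop.coe_le_coe.2 (le_top : (2 : ℕ∞) ≤ ⊤))) b a

theorem Smooth3.Dx_Dy_comm {f : ℝ → ℝ → ℝ → ℝ} (hf : Smooth3 f) (t x y : ℝ) :
    Dx (Dy f) t x y = Dy (Dx f) t x y := by
  have h₁ : Dx (Dy f) t x y = _ := (hf.smooth3_Dy.hasDerivAt_x_s12 t x y).deriv
  have h₂ : Dy (Dx f) t x y = _ := (hf.smooth3_Dx.hasDerivAt_y_s12 t x y).deriv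
  rw [h₁, h₂, hf.uncurry3_Dy, hf.uncurry3_Dx]
  exact fderiv_fderiv_apply_comm hf.contDiff _ _ _

theorem Smooth3.Dx_Dt_comm {f : ℝ → ℝ → ℝ → ℝ} (hf : Smooth3 f) (t x y : ℝ) :
    Dx (Dt f) t x y = Dt (Dx f) t x y := by
  have h₁ : Dx (Dt f) t x y = _ := (hf.smooth3_Dt.hasDerivAt_x_s12 t x y).deriv
  have h₂ : Dt (Dx f) t x y = _ := (hf.smooth3_Dx.hasDerivAt_t_s12 t x y).deriv
  rw [h₁, h₂, hf.uncurry3_Dt, hf.uncurry3_Dx]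
  exact fderiv_fderiv_apply_comm hf.contDiff _ _ _

theorem conservation_law_omega1 (u v p q : ℝ → ℝ → ℝ → ℝ)
    (hu : Smooth3 u) (hv : Smooth3 v) (hp : Smooth3 p) (hq : Smooth3 q)
    (hPMu : PMu u) (hPMv : PMv u v) (hTanP : TanP u p) (hTanQ : TanQ u v p q)
    (X₁ Y₁ : ℝ → ℝ → ℝ → ℝ)
    (hX : X₁ = fun t x y => 2 * Dx u t x y * Dx p t x y + Dy p t x y)
    (hY : Y₁ = fun t x y => Dy u t x y * Dx p t x y + Dx u t x y * Dy p t x y + Dt p t x y) :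
    ∀ t x y : ℝ, Dy X₁ t x y = Dx Y₁ t x y := by
  intro t x y
  have hDy : Dy X₁ t x y = 2 * Dy (Dx u) t x y * Dx p t x y
      + 2 * Dx u t x y * Dy (Dx p) t x y + Dy (Dy p) t x y := by
    rw [hX]
    exact (((hu.smooth3_Dx.hasDerivAt_Dy t x y).const_mul 2).mul
      (hp.smooth3_Dx.hasDerivAt_Dy t x y) |>.add (hp.smooth3_Dy.hasDerivAt_Dy t x y)).deriv
  have hDx : Dx Y₁ t x y = Dx (Dy u) t x y * Dx p t x y + Dy u t x y * Dx (Dx p) t x y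
      + (Dx (Dx u) t x y * Dy p t x y + Dx u t x y * Dx (Dy p) t x y) + Dx (Dt p) t x y := by
    rw [hY]
    exact (((hu.smooth3_Dy.hasDerivAt_Dx t x y).mul (hp.smooth3_Dx.hasDerivAt_Dx t x y)).add
      ((hu.smooth3_Dx.hasDerivAt_Dx t x y).mul (hp.smooth3_Dy.hasDerivAt_Dx t x y)) |>.add
      (hp.smooth3_Dt.hasDerivAt_Dx t x y)).deriv
  rw [hDy, hDx, hu.Dx_Dy_comm, hp.Dx_Dy_comm, hp.Dx_Dt_comm, hTanP]
  ring
end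
end
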